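/- The Ross program (Π_R, W_R) has exactly two optimal answer sets, namely A1(mail) ∪ A3(burn) and A1(mail) ∪ A4(burn); they differ only in whether the agent chooses to burn the letter or not. -/

import Mathlib

namespace ASP

/-- Atoms: the predicates of the common core applied to a constant. -/
inductive Atom (C : Type) where
  | act : C → Atom C
  | O : C → Atom C
  | F : C → Atom C
  | Do : C → Atom C
  | Dia : C → Atom C
  | Happens : C → Atom C
  | Location : C → Atom C
  deriving DecidableEq

/-- A literal is an atom or its strong negation. -/
inductive Lit (C : Type) where
  | pos : Atom C → Lit C
  | neg : Atom C → Lit C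
  deriving DecidableEq

/-- A ground rule: head, positive body, default-negated body. -/
structure Rule (C : Type) where
  head : Set (Lit C)
  pos : Set (Lit C)
  neg : Set (Lit C)

variable {C : Type}

/-- S satisfies the body of r: pos(r) ⊆ S and neg(r) ∩ S = ∅. -/
def SatBody (S : Set (Lit C)) (r : Rule C) : Prop :=
  r.pos ⊆ S ∧ r.neg ∩ S = ∅

/-- S satisfies the head of r: H(r) ∩ S ≠ ∅. -/
def SatHead (S : Set (Lit C)) (r : Rule C) : Prop :=
  (r.head ∩ S).Nonempty

/-- S satisfies a rule r: if S satisfies the body then S satisfies the head. -/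
def Satisfies (S : Set (Lit C)) (r : Rule C) : Prop :=
  SatBody S r → SatHead S r

/-- A set of literals is consistent if it contains no atom together with
its strong negation. -/
def Consistent (S : Set (Lit C)) : Prop :=
  ∀ p : Atom C, ¬ (Lit.pos p ∈ S ∧ Lit.neg p ∈ S)

/-- The reduct Π(S): the rules of Π whose body is satisfied by S. -/
def reduct (P : Set (Rule C)) (S : Set (Lit C)) : Set (Rule C) :=
  {r ∈ P | SatBody S r}

/-- S is an answer set of Π iff S is consistent, S satisfies the head of every
rule in the reduct Π(S), and no proper subset of S satisfies every rule of Π(S). -/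
def IsAnswerSet (P : Set (Rule C)) (S : Set (Lit C)) : Prop :=
  Consistent S ∧ (∀ r ∈ reduct P S, SatHead S r) ∧
    ∀ S' : Set (Lit C), S' ⊂ S → ¬ (∀ r ∈ reduct P S, Satisfies S' r)

/-- The common core program CC(a): the fact act(a) and rules (1)–(9). -/
def CC (a : C) : Set (Rule C) :=
  { ⟨{.pos (.act a)}, ∅, ∅⟩,                                      -- fact act(a)
    ⟨{.pos (.O a), .neg (.O a)}, {.pos (.act a)}, ∅⟩,             -- (1)
    ⟨{.pos (.F a), .neg (.F a)}, {.pos (.act a)}, ∅⟩,             -- (2)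
    ⟨∅, {.pos (.O a), .neg (.Dia a)}, ∅⟩,                         -- (3)
    ⟨{.neg (.Dia a)}, {.neg (.Do a), .pos (.act a)}, ∅⟩,          -- (4)
    ⟨∅, {.pos (.O a), .pos (.F a)}, ∅⟩,                           -- (5)
    ⟨{.pos (.Do a), .neg (.Do a)}, {.pos (.act a)}, ∅⟩,           -- (6)
    ⟨∅, {.pos (.F a), .pos (.Do a)}, ∅⟩,                          -- (7)
    ⟨{.pos (.Happens a)}, {.pos (.Do a)}, ∅⟩,                     -- (8)
    ⟨∅, {.pos (.Do a), .neg (.Dia a)}, ∅⟩ }                       -- (9)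

def A1 (a : C) : Set (Lit C) :=
  {.pos (.act a), .pos (.O a), .neg (.F a), .pos (.Do a), .pos (.Happens a)}

def A2 (a : C) : Set (Lit C) :=
  {.pos (.act a), .pos (.F a), .neg (.O a), .neg (.Do a), .neg (.Dia a)}

def A3 (a : C) : Set (Lit C) :=
  {.pos (.act a), .neg (.F a), .neg (.O a), .neg (.Do a), .neg (.Dia a)}

def A4 (a : C) : Set (Lit C) :=
  {.pos (.act a), .neg (.F a), .neg (.O a), .pos (.Do a), .pos (.Happens a)}

/-- A weak constraint: body (pos, neg), weight w and level l. -/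
structure WeakConstraint (C : Type) where
  pos : Finset (Lit C)
  neg : Finset (Lit C)
  w : ℕ
  l : ℕ
  deriving DecidableEq

/-- S violates a weak constraint c iff pos(c) ⊆ S and neg(c) ∩ S = ∅. -/
def Violates (S : Set (Lit C)) (c : WeakConstraint C) : Prop :=
  ↑c.pos ⊆ S ∧ ↑c.neg ∩ S = ∅

open Classical in
/-- The penalty of S at level lvl: the sum of the weights of the violated
weak constraints of level lvl. -/
noncomputable def penalty (W : Finset (WeakConstraint C)) (S : Set (Lit C))
    (lvl : ℕ) : ℕ :=
  ∑ c ∈ W, if c.l = lvl ∧ Violates S c then c.w else 0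

/-- S is an optimal answer set of Π w.r.t. W iff S is an answer set of Π and
there is no answer set S' of Π and level lvl with strictly smaller penalty at
lvl and equal penalties at all higher levels. -/
def IsOptimalAnswerSet (P : Set (Rule C)) (W : Finset (WeakConstraint C))
    (S : Set (Lit C)) : Prop :=
  IsAnswerSet P S ∧
    ¬ ∃ (S' : Set (Lit C)) (lvl : ℕ), IsAnswerSet P S' ∧
        penalty W S' lvl < penalty W S lvl ∧
        ∀ l', lvl < l' → penalty W S' l' = penalty W S l'

variable [DecidableEq C]

/-- WC(a): the weak constraints ':~ O(a) [1:1]' and ':~ F(a) [1:1]'. -/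
def WC (a : C) : Finset (WeakConstraint C) :=
  { ⟨{.pos (.O a)}, ∅, 1, 1⟩, ⟨{.pos (.F a)}, ∅, 1, 1⟩ }


/-- The constants used in the concrete examples. -/
inductive Const where
  | mail | burn | meet | help | emergency | have_fence | have_white_fence | sea
  deriving DecidableEq


/-- The Ross program: CC(mail) ∪ CC(burn). -/
def RossProgram : Set (Rule Const) := CC Const.mail ∪ CC Const.burn

/-- The weak constraints of the Ross program:
WC(mail) ∪ WC(burn) ∪ { ':~ ¬O(mail) [1:2]' }. -/
def RossW : Finset (WeakConstraint Const) :=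
  WC Const.mail ∪ WC Const.burn ∪ { ⟨{.neg (.O .mail)}, ∅, 1, 2⟩ }


/-- Explicit membership form of: `S'` satisfies every rule of the reduct of `CC a` by `S`. -/
def CCs (S S' : Set (Lit Const)) (a : Const) : Prop :=
  Lit.pos (.act a) ∈ S' ∧
  (Lit.pos (.act a) ∈ S → Lit.pos (.act a) ∈ S' → Lit.pos (.O a) ∈ S' ∨ Lit.neg (.O a) ∈ S') ∧
  (Lit.pos (.act a) ∈ S → Lit.pos (.act a) ∈ S' → Lit.pos (.F a) ∈ S' ∨ Lit.neg (.F a) ∈ S') ∧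
  (Lit.pos (.O a) ∈ S → Lit.neg (.Dia a) ∈ S → Lit.pos (.O a) ∈ S' → Lit.neg (.Dia a) ∉ S') ∧
  (Lit.neg (.Do a) ∈ S → Lit.pos (.act a) ∈ S → Lit.neg (.Do a) ∈ S' → Lit.pos (.act a) ∈ S' →
    Lit.neg (.Dia a) ∈ S') ∧
  (Lit.pos (.O a) ∈ S → Lit.pos (.F a) ∈ S → Lit.pos (.O a) ∈ S' → Lit.pos (.F a) ∉ S') ∧
  (Lit.pos (.act a) ∈ S → Lit.pos (.act a) ∈ S' → Lit.pos (.Do a) ∈ S' ∨ Lit.neg (.Do a) ∈ S') ∧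
  (Lit.pos (.F a) ∈ S → Lit.pos (.Do a) ∈ S → Lit.pos (.F a) ∈ S' → Lit.pos (.Do a) ∉ S') ∧
  (Lit.pos (.Do a) ∈ S → Lit.pos (.Do a) ∈ S' → Lit.pos (.Happens a) ∈ S') ∧
  (Lit.pos (.Do a) ∈ S → Lit.neg (.Dia a) ∈ S → Lit.pos (.Do a) ∈ S' → Lit.neg (.Dia a) ∉ S')

theorem CCs_iff (S S' : Set (Lit Const)) (a : Const) :
    (∀ r ∈ CC a, SatBody S r → Satisfies S' r) ↔ CCs S S' a := by
  simp [CC, CCs, SatBody, Satisfies, SatHead, Set.insert_subset_iff, Set.Nonempty, or_and_right,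
    exists_or]

theorem answer_iff (S : Set (Lit Const)) : IsAnswerSet RossProgram S ↔
    Consistent S ∧ (CCs S S .mail ∧ CCs S S .burn) ∧
      ∀ S' ⊆ S, CCs S S' .mail → CCs S S' .burn → S ⊆ S' := by
  have key : ∀ S', (∀ r ∈ reduct RossProgram S, Satisfies S' r) ↔
      (CCs S S' .mail ∧ CCs S S' .burn) := by
    intro S'
    rw [← CCs_iff, ← CCs_iff]
    constructor
    · intro h
      exact ⟨fun r hr hb => h r ⟨Or.inl hr, hb⟩, fun r hr hb => h r ⟨Or.inr hr, hb⟩⟩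
    · rintro ⟨h1, h2⟩ r ⟨hr | hr, hb⟩
      · exact h1 r hr hb
      · exact h2 r hr hb
  have key2 : (∀ r ∈ reduct RossProgram S, SatHead S r) ↔
      (∀ r ∈ reduct RossProgram S, Satisfies S r) :=
    ⟨fun h r hr _ => h r hr, fun h r hr => h r hr hr.2⟩
  unfold IsAnswerSet
  rw [key2, key]
  refine and_congr_right fun _ => and_congr_right fun _ => ?_
  constructor
  · intro h S' hS h1 h2
    by_contra hn
    exact h S' ⟨hS, hn⟩ ((key S').2 ⟨h1, h2⟩)
  · intro h S' hS hr
    obtain ⟨h1, h2⟩ := (key S').1 hr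
    exact hS.2 (h S' hS.1 h1 h2)

theorem penalty_eq (S : Set (Lit Const)) (l : ℕ) [∀ x, Decidable (x ∈ S)] :
    penalty RossW S l =
      (if l = 1 ∧ Lit.pos (.O .mail) ∈ S then 1 else 0) +
      (if l = 1 ∧ Lit.pos (.F .mail) ∈ S then 1 else 0) +
      (if l = 1 ∧ Lit.pos (.O .burn) ∈ S then 1 else 0) +
      (if l = 1 ∧ Lit.pos (.F .burn) ∈ S then 1 else 0) +
      (if l = 2 ∧ Lit.neg (.O .mail) ∈ S then 1 else 0) := by
  have hW : RossW = {⟨{.pos (.O .mail)}, ∅, 1, 1⟩, ⟨{.pos (.F .mail)}, ∅, 1, 1⟩,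
      ⟨{.pos (.O .burn)}, ∅, 1, 1⟩, ⟨{.pos (.F .burn)}, ∅, 1, 1⟩,
      ⟨{.neg (.O .mail)}, ∅, 1, 2⟩} := by decide
  unfold penalty
  rw [hW, Finset.sum_insert (by decide), Finset.sum_insert (by decide),
    Finset.sum_insert (by decide), Finset.sum_insert (by decide), Finset.sum_singleton]
  simp [Violates, eq_comm, add_assoc]

/-- Each constant's part of an answer set contains one of the four patterns. -/
theorem contains_pattern {S : Set (Lit Const)} {a : Const} (h : CCs S S a) :
    A1 a ⊆ S ∨ A2 a ⊆ S ∨ A3 a ⊆ S ∨ A4 a ⊆ S := by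
  obtain ⟨ha, hO, hF, h3, h4, h5, h6, h7, h8, h9⟩ := h
  simp only [A1, A2, A3, A4, Set.insert_subset_iff, Set.singleton_subset_iff]
  rcases hO ha ha with o | o <;> rcases hF ha ha with f | f <;> rcases h6 ha ha with d | d
  · exact absurd f (h5 o f o)
  · exact absurd f (h5 o f o)
  · exact Or.inl ⟨ha, o, f, d, h8 d d⟩
  · have hd := h4 d ha d ha
    exact absurd hd (h3 o hd o)
  · exact absurd d (h7 f d f)
  · exact Or.inr (Or.inl ⟨ha, f, o, d, h4 d ha d ha⟩)
  · exact Or.inr (Or.inr (Or.inr ⟨ha, f, o, d, h8 d d⟩))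
  · exact Or.inr (Or.inr (Or.inl ⟨ha, f, o, d, h4 d ha d ha⟩))

/-- A set that agrees with a pattern on the literals of `a` satisfies the rules of `CC a`. -/
theorem CCs_union {X Y : Set (Lit Const)} {a b : Const} (hab : a ≠ b) (S : Set (Lit Const))
    (hX : X = A1 a ∨ X = A2 a ∨ X = A3 a ∨ X = A4 a)
    (hY : Y = A1 b ∨ Y = A2 b ∨ Y = A3 b ∨ Y = A4 b) : CCs S (X ∪ Y) a := by
  rcases hX with rfl | rfl | rfl | rfl <;> rcases hY with rfl | rfl | rfl | rfl <;>
    simp [CCs, A1, A2, A3, A4, hab]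

theorem answer_form {S : Set (Lit Const)} (h : IsAnswerSet RossProgram S) :
    ∃ X Y, (X = A1 Const.mail ∨ X = A2 Const.mail ∨ X = A3 Const.mail ∨ X = A4 Const.mail) ∧
      (Y = A1 Const.burn ∨ Y = A2 Const.burn ∨ Y = A3 Const.burn ∨ Y = A4 Const.burn) ∧
      S = X ∪ Y := by
  obtain ⟨_, ⟨hm, hb⟩, hmin⟩ := (answer_iff S).1 h
  have ex : ∀ a, CCs S S a → ∃ X, (X = A1 a ∨ X = A2 a ∨ X = A3 a ∨ X = A4 a) ∧ X ⊆ S := by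
    intro a ha
    rcases contains_pattern ha with h | h | h | h <;> exact ⟨_, by simp, h⟩
  obtain ⟨X, hX, hXS⟩ := ex _ hm
  obtain ⟨Y, hY, hYS⟩ := ex _ hb
  have hsub : X ∪ Y ⊆ S := Set.union_subset hXS hYS
  refine ⟨X, Y, hX, hY, Set.Subset.antisymm (hmin _ hsub ?_ ?_) hsub⟩
  · exact CCs_union (by decide) S hX hY
  · rw [Set.union_comm]
    exact CCs_union (by decide) S hY hX

theorem answer13 : IsAnswerSet RossProgram (A1 Const.mail ∪ A3 Const.burn) := by
  rw [answer_iff]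
  refine ⟨?_, ⟨CCs_union (b := Const.burn) (by decide) _ (by simp) (by simp), ?_⟩, ?_⟩
  · intro p; rcases p with c | c | c | c | c | c | c <;> cases c <;> simp [A1, A3]
  · rw [Set.union_comm]; exact CCs_union (b := Const.mail) (by decide) _ (by simp) (by simp)
  · intro S' hS h1 h2
    have hn : ∀ x, x ∉ A1 Const.mail ∪ A3 Const.burn → x ∉ S' := fun x hx hx' => hx (hS hx')
    have n1 := hn (.neg (.O .mail)) (by simp [A1, A3])
    have n2 := hn (.pos (.F .mail)) (by simp [A1, A3])
    have n3 := hn (.neg (.Do .mail)) (by simp [A1, A3])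
    have n4 := hn (.pos (.O .burn)) (by simp [A1, A3])
    have n5 := hn (.pos (.F .burn)) (by simp [A1, A3])
    have n6 := hn (.pos (.Do .burn)) (by simp [A1, A3])
    simp [CCs, A1, A3, n1, n2, n3] at h1
    simp [CCs, A1, A3, n4, n5, n6] at h2
    simp only [A1, A3, Set.union_subset_iff, Set.insert_subset_iff, Set.singleton_subset_iff]
    simp_all

theorem answer14 : IsAnswerSet RossProgram (A1 Const.mail ∪ A4 Const.burn) := by
  rw [answer_iff]
  refine ⟨?_, ⟨CCs_union (b := Const.burn) (by decide) _ (by simp) (by simp), ?_⟩, ?_⟩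
  · intro p; rcases p with c | c | c | c | c | c | c <;> cases c <;> simp [A1, A4]
  · rw [Set.union_comm]; exact CCs_union (b := Const.mail) (by decide) _ (by simp) (by simp)
  · intro S' hS h1 h2
    have hn : ∀ x, x ∉ A1 Const.mail ∪ A4 Const.burn → x ∉ S' := fun x hx hx' => hx (hS hx')
    have n1 := hn (.neg (.O .mail)) (by simp [A1, A4])
    have n2 := hn (.pos (.F .mail)) (by simp [A1, A4])
    have n3 := hn (.neg (.Do .mail)) (by simp [A1, A4])
    have n4 := hn (.pos (.O .burn)) (by simp [A1, A4])
    have n5 := hn (.pos (.F .burn)) (by simp [A1, A4])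
    have n6 := hn (.neg (.Do .burn)) (by simp [A1, A4])
    simp [CCs, A1, A4, n1, n2, n3] at h1
    simp [CCs, A1, A4, n4, n5, n6] at h2
    simp only [A1, A4, Set.union_subset_iff, Set.insert_subset_iff, Set.singleton_subset_iff]
    simp_all

theorem penalty13 (l : ℕ) :
    penalty RossW (A1 Const.mail ∪ A3 Const.burn) l = if l = 1 then 1 else 0 := by
  classical
  rw [penalty_eq]; simp [A1, A3]

theorem penalty14 (l : ℕ) :
    penalty RossW (A1 Const.mail ∪ A4 Const.burn) l = if l = 1 then 1 else 0 := by
  classical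
  rw [penalty_eq]; simp [A1, A4]

theorem not_better {S' : Set (Lit Const)} (h : IsAnswerSet RossProgram S') (lvl : ℕ)
    (hlt : penalty RossW S' lvl < if lvl = 1 then 1 else 0)
    (heq : ∀ l', lvl < l' → penalty RossW S' l' = if l' = 1 then 1 else 0) : False := by
  classical
  have hl : lvl = 1 := by
    by_contra hne
    simp [hne] at hlt
  subst hl
  have h2 := heq 2 (by norm_num)
  rw [penalty_eq] at hlt h2
  obtain ⟨_, ⟨⟨ha, hO, _⟩, _⟩, _⟩ := (answer_iff S').1 h
  rcases hO ha ha with hO | hO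
  · simp [hO] at hlt
  · simp [hO] at h2

/-- the Ross program has exactly two optimal answer sets,
A1(mail) ∪ A3(burn) and A1(mail) ∪ A4(burn). -/
theorem stmt15 :
    ∀ S : Set (Lit Const), IsOptimalAnswerSet RossProgram RossW S ↔
      (S = A1 Const.mail ∪ A3 Const.burn ∨ S = A1 Const.mail ∪ A4 Const.burn) := by
  classical
  intro S
  constructor
  · rintro ⟨hS, hopt⟩
    by_contra hne
    apply hopt
    obtain ⟨X, Y, hX, hY, rfl⟩ := answer_form hS
    rcases hX with rfl | hX
    · refine ⟨_, 1, answer13, ?_, ?_⟩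
      · rw [penalty13, penalty_eq]
        rcases hY with rfl | rfl | rfl | rfl
        · simp [A1]
        · simp [A1, A2]
        · simp at hne
        · simp at hne
      · intro l' hl'
        rw [penalty13, penalty_eq]
        rcases hY with rfl | rfl | rfl | rfl <;> simp [A1, A2, A3, A4] <;> omega
    · refine ⟨_, 2, answer13, ?_, ?_⟩
      · rw [penalty13, penalty_eq]
        rcases hX with rfl | rfl | rfl <;> simp [A2, A3, A4]
      · intro l' hl'
        have h1 : l' ≠ 1 := by omega
        have h2 : l' ≠ 2 := by omega
        rw [penalty13, penalty_eq]
        simp [h1, h2]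
  · rintro (rfl | rfl)
    · refine ⟨answer13, ?_⟩
      rintro ⟨S', lvl, hS', hlt, heq⟩
      simp only [penalty13] at hlt heq
      exact not_better hS' lvl hlt heq
    · refine ⟨answer14, ?_⟩
      rintro ⟨S', lvl, hS', hlt, heq⟩
      simp only [penalty14] at hlt heq
      exact not_better hS' lvl hlt heq

end ASP
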